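/- arXiv:gr-qc/0612098 — 3 statements merged into one kernel-verified Lean document; each statement's English description precedes it below -/
import Mathlib

section
/- Riesz formula for the electromagnetic energy–momentum densities: for every antisymmetric real 4×4 matrix G and every vector x ∈ Fin 4 → ℝ, the Clifford element (1/2) • (Φ * ι Q x * reverse Φ) lies in the image of ι Q; explicitly, (1/2) • (Φ * ι Q x * reverse Φ) = ι Q y, where y is the vector with components y d = ∑_{c} η d d * T d c * x c, and T a b := −∑_{c} η c c * G a c * G b c + (1/4) * (∑_{c,d} η c c * η d d * (G c d)^2) * η a b are the components of the Maxwell energy–momentum tensor of G. (This is the paper's noticeable formula 𝒯_a = (1/2) F ϑ_a F̃.) -/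
noncomputable section

open CliffordAlgebra Finset Matrix

/-- The Minkowski metric matrix `diag(1,-1,-1,-1)`. -/
def η : Matrix (Fin 4) (Fin 4) ℝ := Matrix.diagonal ![1, -1, -1, -1]

/-- The Minkowski quadratic form on `Fin 4 → ℝ`:
`Q x = (x 0)^2 - (x 1)^2 - (x 2)^2 - (x 3)^2`. -/
def Q : QuadraticForm ℝ (Fin 4 → ℝ) :=
  QuadraticMap.weightedSumSquares ℝ ![(1 : ℝ), -1, -1, -1]

/-- The bilinear form associated with `Q`. -/
def B (x y : Fin 4 → ℝ) : ℝ := (Q (x + y) - Q x - Q y) / 2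

/-- The standard basis of `Fin 4 → ℝ`. -/
def e (a : Fin 4) : Fin 4 → ℝ := Pi.single a 1

/-- The Dirac gamma `γ a = ι Q (e a)`. -/
def γ (a : Fin 4) : CliffordAlgebra Q := ι Q (e a)

/-- The electromagnetic bivector `Φ = (1/2) F_{ab} γ^a γ^b`
(indices raised with `η`). -/
def Φ (G : Matrix (Fin 4) (Fin 4) ℝ) : CliffordAlgebra Q :=
  (1 / 2 : ℝ) • ∑ a : Fin 4, ∑ b : Fin 4, (η a a * η b b * G a b) • (γ a * γ b)

/-- The Maxwell energy–momentum tensor of `G`. -/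
def T (G : Matrix (Fin 4) (Fin 4) ℝ) (a b : Fin 4) : ℝ :=
  -∑ c : Fin 4, η c c * G a c * G b c
    + (1 / 4) * (∑ c : Fin 4, ∑ d : Fin 4, η c c * η d d * (G c d) ^ 2) * η a b

theorem ι_eq_sum_smul_γ (x : Fin 4 → ℝ) : ι Q x = ∑ a : Fin 4, x a • γ a := by
  simp only [γ, e, ← map_smul, ← map_sum]
  congr 1
  exact pi_eq_sum_univ' x

theorem γ_mul_self (a : Fin 4) : γ a * γ a = algebraMap ℝ _ (η a a) := by
  rw [γ, ι_sq_scalar]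
  congr 1
  fin_cases a <;> simp [Q, e, η, QuadraticMap.weightedSumSquares_apply, Fin.sum_univ_four]

theorem γ_mul_γ_of_ne {a b : Fin 4} (h : a ≠ b) : γ a * γ b = -(γ b * γ a) := by
  rw [eq_neg_iff_add_eq_zero, γ, γ, ι_mul_ι_add_swap, QuadraticMap.polar,
    ← map_zero (algebraMap ℝ (CliffordAlgebra Q))]
  congr 1
  fin_cases a <;> fin_cases b <;>
    simp_all [Q, e, QuadraticMap.weightedSumSquares_apply, Fin.sum_univ_four]

/-- The bivector `Φ G` of an antisymmetric `G` in the six ordered products of gammas. -/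
theorem Φ_eq {G : Matrix (Fin 4) (Fin 4) ℝ} (hG : ∀ a b, G b a = -G a b) :
    Φ G = -G 0 1 • (γ 0 * γ 1) - G 0 2 • (γ 0 * γ 2) - G 0 3 • (γ 0 * γ 3)
      + G 1 2 • (γ 1 * γ 2) + G 1 3 • (γ 1 * γ 3) + G 2 3 • (γ 2 * γ 3) := by
  have hd (a : Fin 4) : G a a = 0 := self_eq_neg.mp (hG a a)
  simp only [Φ, Fin.sum_univ_four, hd, hG 0 1, hG 0 2, hG 0 3, hG 1 2, hG 1 3, hG 2 3,
    γ_mul_γ_of_ne (show (1 : Fin 4) ≠ 0 by decide),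
    γ_mul_γ_of_ne (show (2 : Fin 4) ≠ 0 by decide),
    γ_mul_γ_of_ne (show (3 : Fin 4) ≠ 0 by decide),
    γ_mul_γ_of_ne (show (2 : Fin 4) ≠ 1 by decide),
    γ_mul_γ_of_ne (show (3 : Fin 4) ≠ 1 by decide),
    γ_mul_γ_of_ne (show (3 : Fin 4) ≠ 2 by decide)]
  simp only [η, diagonal_apply_eq, Matrix.cons_val]
  module

theorem reverse_γ_mul_γ (a b : Fin 4) : reverse (R := ℝ) (γ a * γ b) = γ b * γ a := by
  simp [γ, reverse.map_mul]

theorem reverse_Φ {G : Matrix (Fin 4) (Fin 4) ℝ} (hG : ∀ a b, G b a = -G a b) :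
    reverse (R := ℝ) (Φ G) = -Φ G := by
  simp only [Φ, map_smul, map_sum, reverse_γ_mul_γ]
  rw [Finset.sum_comm, ← smul_neg, ← Finset.sum_neg_distrib]
  congr 1
  refine Finset.sum_congr rfl fun a _ => ?_
  rw [← Finset.sum_neg_distrib]
  refine Finset.sum_congr rfl fun b _ => ?_
  rw [hG a b]
  module

/-- **Riesz formula**: `(1/2) F ϑ_a F̃` is the energy–momentum `1`-form,
i.e. the Clifford sandwich of a vector between `Φ` and its reverse is the vector
obtained by contracting with the Maxwell energy–momentum tensor. -/
theorem riesz_energy_momentum (G : Matrix (Fin 4) (Fin 4) ℝ) (hG : Gᵀ = -G)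
    (x : Fin 4 → ℝ) :
    (1 / 2 : ℝ) • (Φ G * ι Q x * reverse (R := ℝ) (Φ G)) =
      ι Q (fun d => ∑ c : Fin 4, η d d * T G d c * x c) := by
  have hanti (a b : Fin 4) : G b a = -G a b := congrFun (congrFun hG a) b
  have hd (a : Fin 4) : G a a = 0 := self_eq_neg.mp (hanti a a)
  have sq (a : Fin 4) : γ a * γ a = η a a • 1 := by
    rw [γ_mul_self, Algebra.algebraMap_eq_smul_one]
  have sq_mul (a : Fin 4) (z : CliffordAlgebra Q) : γ a * (γ a * z) = η a a • z := by
    rw [← mul_assoc, sq, smul_one_mul]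
  have swap (a b : Fin 4) (h : b < a) : γ a * γ b = -(γ b * γ a) := γ_mul_γ_of_ne h.ne'
  have swap_mul (a b : Fin 4) (h : b < a) (z : CliffordAlgebra Q) :
      γ a * (γ b * z) = -(γ b * (γ a * z)) := by
    rw [← mul_assoc, swap a b h, neg_mul, mul_assoc]
  rw [reverse_Φ hanti, Φ_eq hanti, ι_eq_sum_smul_γ x, ι_eq_sum_smul_γ]
  simp only [Fin.sum_univ_four, T, hd, hanti 0 1, hanti 0 2, hanti 0 3,
    hanti 1 2, hanti 1 3, hanti 2 3]
  simp only [mul_add, add_mul, mul_sub, sub_mul, smul_mul_assoc, mul_smul_comm, mul_neg, neg_mul,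
    mul_assoc, sq, sq_mul, mul_one, smul_neg, neg_smul, neg_neg,
    swap 1 0 (by decide), swap 2 0 (by decide), swap 3 0 (by decide),
    swap 2 1 (by decide), swap 3 1 (by decide), swap 3 2 (by decide),
    swap_mul 1 0 (by decide), swap_mul 2 0 (by decide), swap_mul 3 0 (by decide),
    swap_mul 2 1 (by decide), swap_mul 3 1 (by decide), swap_mul 3 2 (by decide)]
  simp only [η, diagonal_apply, Matrix.cons_val, Fin.reduceEq, if_true, if_false]
  module
end
end

section
/- Conservation of the energy–momentum densities of a free electromagnetic field (δ𝒯^a = 0): let F : (Fin 4 → ℝ) → Fin 4 → Fin 4 → ℝ be continuously differentiable with F x a b = −F x b a for all x, a, b, and suppose F satisfies the free Maxwell equations: for all a, b, c and all points, ∂_a (F · b c) + ∂_b (F · c a) + ∂_c (F · a b) = 0, and for all ν and all points, ∑_μ η μ μ * ∂_μ (F · μ ν) = 0. Define the energy–momentum tensor T x a b := −∑_c η c c * F x a c * F x b c + (1/4) * (∑_{c,d} η c c * η d d * (F x c d)^2) * η a b. Then for every a ∈ Fin 4 and every point x, ∑_μ η μ μ * ∂_μ (fun y => T y μ a) x = 0.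 -/
noncomputable section

open Matrix

/-- The partial derivative of `f` along the `μ`-th standard basis direction. -/
def pd (μ : Fin 4) (f : (Fin 4 → ℝ) → ℝ) (x : Fin 4 → ℝ) : ℝ :=
  fderiv ℝ f x (Pi.single μ 1)

/-- The Maxwell energy–momentum tensor of a field strength `F`. -/
def Tem (F : (Fin 4 → ℝ) → Fin 4 → Fin 4 → ℝ) (x : Fin 4 → ℝ) (a b : Fin 4) : ℝ :=
  -∑ c : Fin 4, η c c * F x a c * F x b c
    + (1 / 4) * (∑ c : Fin 4, ∑ d : Fin 4, η c c * η d d * (F x c d) ^ 2) * η a b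

theorem η_apply_self_mul_self (a : Fin 4) : η a a * η a a = 1 := by
  fin_cases a <;> simp [η]

theorem η_apply_of_ne {a b : Fin 4} (h : a ≠ b) : η a b = 0 :=
  Matrix.diagonal_apply_ne _ h

theorem pd_antisymm {F : (Fin 4 → ℝ) → Fin 4 → Fin 4 → ℝ} (hanti : ∀ x a b, F x a b = -F x b a)
    (μ a b : Fin 4) (x : Fin 4 → ℝ) :
    pd μ (fun y => F y a b) x = -pd μ (fun y => F y b a) x := by
  have h : (fun y => F y a b) = fun y => -F y b a := funext fun y => hanti y a b
  rw [h, pd, fderiv_fun_neg]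
  rfl

/-- The product rule for the energy–momentum tensor. -/
theorem pd_Tem {F : (Fin 4 → ℝ) → Fin 4 → Fin 4 → ℝ} {x : Fin 4 → ℝ}
    (hF : ∀ a b, DifferentiableAt ℝ (fun y => F y a b) x) (μ a b : Fin 4) :
    pd μ (fun y => Tem F y a b) x =
      -∑ c, η c c * (pd μ (fun y => F y a c) x * F x b c + F x a c * pd μ (fun y => F y b c) x)
        + (1 / 2) * (∑ c, ∑ d, η c c * η d d * (F x c d * pd μ (fun y => F y c d) x)) * η a b := by
  have hd (c d : Fin 4) := (hF c d).hasFDerivAt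
  have h := ((HasFDerivAt.fun_sum (u := Finset.univ) fun c _ =>
      ((hd a c).const_mul (η c c)).mul (hd b c)).neg).add
    (((HasFDerivAt.fun_sum (u := Finset.univ) fun c _ => HasFDerivAt.fun_sum (u := Finset.univ)
      fun d _ => ((hd c d).pow 2).const_mul (η c c * η d d)).const_mul (1 / 4)).mul_const (η a b))
  have h' : HasFDerivAt (fun y => Tem F y a b) _ x := h
  rw [pd, h'.fderiv]
  simp only [pd, _root_.add_apply, _root_.neg_apply, _root_.sum_apply, _root_.smul_apply,
    smul_eq_mul, nsmul_eq_mul]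
  congr 1
  · exact congrArg _ (Finset.sum_congr rfl fun c _ => by ring)
  · simp only [Finset.mul_sum, Finset.sum_mul]
    refine Finset.sum_congr rfl fun c _ => Finset.sum_congr rfl fun d _ => ?_
    push_cast
    ring

/-- Conservation of the energy–momentum densities of a free electromagnetic
field: `δ𝒯^a = 0`. -/
theorem energy_momentum_conserved (F : (Fin 4 → ℝ) → Fin 4 → Fin 4 → ℝ)
    (hF : ∀ a b, ContDiff ℝ 1 (fun x => F x a b))
    (hanti : ∀ x a b, F x a b = -F x b a)
    (hbianchi : ∀ a b c, ∀ x : Fin 4 → ℝ,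
      pd a (fun y => F y b c) x + pd b (fun y => F y c a) x
        + pd c (fun y => F y a b) x = 0)
    (hmaxwell : ∀ ν, ∀ x : Fin 4 → ℝ,
      ∑ μ : Fin 4, η μ μ * pd μ (fun y => F y μ ν) x = 0)
    (a : Fin 4) (x : Fin 4 → ℝ) :
    ∑ μ : Fin 4, η μ μ * pd μ (fun y => Tem F y μ a) x = 0 := by
  have hd (c d : Fin 4) : DifferentiableAt ℝ (fun y => F y c d) x :=
    (hF c d).differentiable one_ne_zero x
  simp only [pd_Tem hd]
  set D : Fin 4 → Fin 4 → Fin 4 → ℝ := fun μ c d => pd μ (fun y => F y c d) x with hD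
  change ∑ μ, η μ μ * (-∑ c, η c c * (D μ μ c * F x a c + F x μ c * D μ a c)
    + (1 / 2) * (∑ c, ∑ d, η c c * η d d * (F x c d * D μ c d)) * η μ a) = 0
  have hsource : ∑ μ, ∑ c, η μ μ * η c c * (D μ μ c * F x a c) = 0 := by
    rw [Finset.sum_comm]
    refine Finset.sum_eq_zero fun c _ => ?_
    have h := congrArg (fun t => η c c * F x a c * t) (hmaxwell c x)
    simp only [Finset.mul_sum, mul_zero] at h
    rw [← h]
    exact Finset.sum_congr rfl fun μ _ => by simp only [hD]; ring
  have hforce : 2 * ∑ μ, ∑ c, η μ μ * η c c * (F x μ c * D μ a c)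
      = ∑ μ, ∑ c, η μ μ * η c c * (F x μ c * D a μ c) := by
    rw [two_mul]
    nth_rewrite 2 [Finset.sum_comm]
    simp only [← Finset.sum_add_distrib]
    refine Finset.sum_congr rfl fun μ _ => Finset.sum_congr rfl fun c _ => ?_
    have h₁ : D a μ c + D μ c a + D c a μ = 0 := hbianchi a μ c x
    have h₂ : D μ c a = -D μ a c := pd_antisymm hanti μ c a x
    rw [hanti x c μ]
    linear_combination (-η μ μ * η c c * F x μ c) * (h₁ - h₂)
  have htrace : ∑ μ, η μ μ * ((1 / 2) * (∑ c, ∑ d, η c c * η d d * (F x c d * D μ c d)) * η μ a)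
      = (1 / 2) * ∑ c, ∑ d, η c c * η d d * (F x c d * D a c d) := by
    rw [Finset.sum_eq_single a (fun μ _ h => by rw [η_apply_of_ne h]; ring) (by simp)]
    linear_combination (1 / 2 * ∑ c, ∑ d, η c c * η d d * (F x c d * D a c d)) *
      η_apply_self_mul_self a
  have hsplit : ∑ μ, η μ μ * -∑ c, η c c * (D μ μ c * F x a c + F x μ c * D μ a c)
      = -(∑ μ, ∑ c, η μ μ * η c c * (D μ μ c * F x a c)
        + ∑ μ, ∑ c, η μ μ * η c c * (F x μ c * D μ a c)) := by
    simp only [← Finset.sum_add_distrib, ← Finset.sum_neg_distrib, Finset.mul_sum]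
    exact Finset.sum_congr rfl fun μ _ => Finset.sum_congr rfl fun c _ => by ring
  simp only [mul_add (η _ _) (-_)]
  rw [Finset.sum_add_distrib, hsplit, htrace]
  linear_combination -hsource - (1 / 2) * hforce
end
end

section
/- Existence of a 2-form co-potential for any conserved current on Minkowski spacetime (the step 'since we are in Minkowski spacetime there must exist 𝒲^a with δ𝒲^a = −𝒯^a'): let J : (Fin 4 → ℝ) → (Fin 4 → ℝ) be smooth (C^∞) with ∑_μ η μ μ * ∂_μ (fun y => J y μ) x = 0 for every point x. Then there exists a smooth W : (Fin 4 → ℝ) → Fin 4 → Fin 4 → ℝ with W x μ ν = −W x ν μ for all x, μ, ν, such that for every ν and every point x, ∑_μ η μ μ * ∂_μ (fun y => W y μ ν) x = J x ν. -/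
noncomputable section

open Matrix

section ParametricIntegral

open MeasureTheory intervalIntegral Metric Set
open scoped ContDiff

universe u

variable {H E : Type u} [NormedAddCommGroup H] [NormedSpace ℝ H] [ProperSpace H]
  [NormedAddCommGroup E] [NormedSpace ℝ E]

/-- Differentiation under the integral sign for a jointly `C¹` integrand on a compact interval. -/
theorem hasFDerivAt_intervalIntegral_of_contDiff {f : H → ℝ → E}
    (hf : ContDiff ℝ 1 (Function.uncurry f)) (a b : ℝ) (x : H) :
    HasFDerivAt (fun y => ∫ t in a..b, f y t) (∫ t in a..b, fderiv ℝ (fun y => f y t) x) x := by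
  have hcont : Continuous fun p : H × ℝ => fderiv ℝ (fun y => f y p.2) p.1 := by
    refine ContDiff.continuous (𝕜 := ℝ) (n := 0) ?_
    refine ContDiff.fderiv (f := fun (p : H × ℝ) y => f y p.2) (m := 1) ?_ contDiff_fst
      (n := 0) (by norm_num)
    exact hf.comp (contDiff_snd.prodMk (contDiff_snd.comp contDiff_fst))
  obtain ⟨C, hC⟩ := ((isCompact_closedBall x 1).prod
    (isCompact_uIcc (a := a) (b := b))).exists_bound_of_continuousOn hcont.continuousOn
  have hft (y : H) : Continuous (f y) :=
    hf.continuous.comp (by fun_prop : Continuous fun t => (y, t))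
  refine hasFDerivAt_integral_of_dominated_of_fderiv_le
    (F' := fun y t => fderiv ℝ (fun z => f z t) y) (bound := fun _ => C)
    (closedBall_mem_nhds x one_pos)
    (.of_forall fun y => (hft y).aestronglyMeasurable)
    ((hft x).intervalIntegrable _ _)
    (hcont.comp (by fun_prop : Continuous fun t : ℝ => (x, t))).aestronglyMeasurable
    (.of_forall fun t ht y hy => hC (y, t) ⟨hy, uIoc_subset_uIcc ht⟩)
    intervalIntegrable_const
    (.of_forall fun t _ y _ => ?_)
  exact ((hf.comp (contDiff_id.prodMk contDiff_const)).differentiable one_ne_zero y).hasFDerivAt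

/-- The integral over a compact interval of a jointly smooth integrand is smooth. -/
theorem contDiff_intervalIntegral {f : H → ℝ → E}
    (hf : ContDiff ℝ ∞ (Function.uncurry f)) (a b : ℝ) :
    ContDiff ℝ ∞ fun x => ∫ t in a..b, f x t := by
  refine contDiff_infty.2 fun n => ?_
  induction n generalizing E with
  | zero =>
    exact contDiff_zero.2 (continuous_parametric_intervalIntegral_of_continuous' hf.continuous a b)
  | succ n ih =>
    refine contDiff_succ_iff_hasFDerivAt.2 ⟨_, ih (f := fun x t => fderiv ℝ (fun y => f y t) x) ?_,
      fun x => hasFDerivAt_intervalIntegral_of_contDiff (hf.of_le (by exact_mod_cast le_top)) a b x⟩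
    refine ContDiff.fderiv (f := fun (p : H × ℝ) y => f y p.2) (n := ∞) ?_ contDiff_fst
      (m := ∞) (by norm_num)
    exact hf.comp (contDiff_snd.prodMk (contDiff_snd.comp contDiff_fst))

end ParametricIntegral

section RadialAverage

open intervalIntegral
open scoped ContDiff

variable {V E : Type} [NormedAddCommGroup V] [NormedSpace ℝ V] [NormedAddCommGroup E]
  [NormedSpace ℝ E]

/-- The weighted radial average `x ↦ ∫₀¹ t² J(tx) dt`. -/
def radialAverage (J : V → E) (x : V) : E := ∫ t in (0 : ℝ)..1, t ^ 2 • J (t • x)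

variable {J : V → E}

theorem contDiff_radialAverage [ProperSpace V] (hJ : ContDiff ℝ ∞ J) :
    ContDiff ℝ ∞ (radialAverage J) := by
  refine contDiff_intervalIntegral (f := fun x t => t ^ 2 • J (t • x)) ?_ 0 1
  exact (contDiff_snd.pow 2).smul (hJ.comp (contDiff_snd.smul contDiff_fst))

theorem fderiv_radialAverage [ProperSpace V] (hJ : ContDiff ℝ ∞ J) (x : V) :
    fderiv ℝ (radialAverage J) x = ∫ t in (0 : ℝ)..1, t ^ 3 • fderiv ℝ J (t • x) := by
  have h := hasFDerivAt_intervalIntegral_of_contDiff (f := fun x t => t ^ 2 • J (t • x))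
    (((contDiff_snd.pow 2).smul (hJ.comp (contDiff_snd.smul contDiff_fst))).of_le
      (by exact_mod_cast le_top)) 0 1 x
  refine h.fderiv.trans (integral_congr fun t _ => ?_)
  have hd : HasFDerivAt (fun y : V => t ^ 2 • J (t • y))
      (t ^ 2 • (fderiv ℝ J (t • x)).comp (t • ContinuousLinearMap.id ℝ V)) x :=
    (((hJ.differentiable (by simp) (t • x)).hasFDerivAt).comp x
      ((hasFDerivAt_id x).const_smul t)).const_smul (t ^ 2)
  refine hd.fderiv.trans ?_
  ext v
  simp [smul_smul, pow_succ]

theorem continuous_pow_smul_fderiv_smul (hJ : ContDiff ℝ ∞ J) (n : ℕ) (x : V) :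
    Continuous fun t : ℝ => t ^ n • fderiv ℝ J (t • x) := by
  have := hJ.continuous_fderiv (by simp)
  fun_prop

/-- Euler's identity for the weighted radial average. -/
theorem three_smul_radialAverage_add_fderiv [ProperSpace V] [CompleteSpace E]
    (hJ : ContDiff ℝ ∞ J) (x : V) :
    (3 : ℝ) • radialAverage J x + fderiv ℝ (radialAverage J) x x = J x := by
  have hc := continuous_pow_smul_fderiv_smul hJ 3 x
  have hcJ : Continuous fun t : ℝ => t ^ 2 • J (t • x) := by
    have := hJ.continuous
    fun_prop
  have hcx : Continuous fun t : ℝ => (t ^ 3 • fderiv ℝ J (t • x)) x := by fun_prop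
  have hsum : Continuous fun t : ℝ =>
      (3 : ℝ) • t ^ 2 • J (t • x) + (t ^ 3 • fderiv ℝ J (t • x)) x := (hcJ.const_smul 3).add hcx
  rw [fderiv_radialAverage hJ, radialAverage, ← integral_smul,
    ContinuousLinearMap.intervalIntegral_apply (hc.intervalIntegrable _ _),
    ← integral_add (f := fun t => (3 : ℝ) • t ^ 2 • J (t • x))
      (g := fun t => (t ^ 3 • fderiv ℝ J (t • x)) x) ((hcJ.const_smul (3 : ℝ)).intervalIntegrable _ _)
      (hcx.intervalIntegrable _ _),
    integral_eq_sub_of_hasDerivAt (f := fun t : ℝ => t ^ 3 • J (t • x)) _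
      (hsum.intervalIntegrable _ _)]
  · simp
  · intro t _
    have h1 : HasDerivAt (fun s : ℝ => J (s • x)) (fderiv ℝ J (t • x) x) t := by
      have h := (hJ.differentiable (by simp) (t • x)).hasFDerivAt.comp_hasDerivAt t
        ((hasDerivAt_id t).smul_const x)
      simpa using! h
    convert (hasDerivAt_pow 3 t).smul h1 using 1
    · rfl
    · simp [smul_smul, add_comm]

/-- A linear first-order equation for `J` is inherited by its weighted radial average. -/
theorem map_fderiv_radialAverage_eq_zero [ProperSpace V] [CompleteSpace E]
    (hJ : ContDiff ℝ ∞ J) (Φ : (V →L[ℝ] E) →L[ℝ] ℝ) (hΦ : ∀ x, Φ (fderiv ℝ J x) = 0) (x : V) :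
    Φ (fderiv ℝ (radialAverage J) x) = 0 := by
  rw [fderiv_radialAverage hJ, ← ContinuousLinearMap.intervalIntegral_comp_comm Φ
    ((continuous_pow_smul_fderiv_smul hJ 3 x).intervalIntegrable _ _)]
  simp [hΦ]

end RadialAverage

theorem pd_apply {J : (Fin 4 → ℝ) → (Fin 4 → ℝ)} {x : Fin 4 → ℝ} (hJ : DifferentiableAt ℝ J x)
    (μ ν : Fin 4) : pd μ (fun y => J y ν) x = fderiv ℝ J x (Pi.single μ 1) ν := by
  rw [pd, (hasFDerivAt_pi'.1 hJ.hasFDerivAt ν).fderiv]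
  rfl

theorem pd_mul_coord {g : (Fin 4 → ℝ) → ℝ} {x : Fin 4 → ℝ} (hg : DifferentiableAt ℝ g x) (c : ℝ)
    (μ ν : Fin 4) : pd μ (fun y => c * y ν * g y) x =
      c * ((Pi.single μ 1 : Fin 4 → ℝ) ν * g x + x ν * pd μ g x) := by
  have h : HasFDerivAt (fun y : Fin 4 → ℝ => c * y ν * g y) _ x :=
    ((hasFDerivAt_apply (𝕜 := ℝ) ν x).const_mul c).mul hg.hasFDerivAt
  rw [pd, h.fderiv]
  simp [pd]
  ring

theorem pd_sub {f g : (Fin 4 → ℝ) → ℝ} {x : Fin 4 → ℝ} (hf : DifferentiableAt ℝ f x)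
    (hg : DifferentiableAt ℝ g x) (μ : Fin 4) :
    pd μ (fun y => f y - g y) x = pd μ f x - pd μ g x := by
  rw [pd, fderiv_fun_sub hf hg]
  rfl

/-- Existence of a 2-form co-potential for any conserved current on Minkowski
spacetime: there exists an antisymmetric `W` with `δW = -J`. -/
theorem exists_copotential (J : (Fin 4 → ℝ) → (Fin 4 → ℝ))
    (hJ : ContDiff ℝ (⊤ : ℕ∞) J)
    (hconserved : ∀ x : Fin 4 → ℝ,
      ∑ μ : Fin 4, η μ μ * pd μ (fun y => J y μ) x = 0) :
    ∃ W : (Fin 4 → ℝ) → Fin 4 → Fin 4 → ℝ,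
      (∀ μ ν, ContDiff ℝ (⊤ : ℕ∞) (fun x => W x μ ν)) ∧
      (∀ x μ ν, W x μ ν = -W x ν μ) ∧
      (∀ ν, ∀ x : Fin 4 → ℝ,
        ∑ μ : Fin 4, η μ μ * pd μ (fun y => W y μ ν) x = J x ν) := by
  set G := radialAverage J
  have hG : ContDiff ℝ (⊤ : ℕ∞) G := contDiff_radialAverage hJ
  have hGd (x : Fin 4 → ℝ) : DifferentiableAt ℝ G x := hG.differentiable (by simp) x
  have hGi (ν : Fin 4) : ContDiff ℝ (⊤ : ℕ∞) fun x => G x ν := contDiff_pi.1 hG ν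
  have hW (μ ν : Fin 4) : ContDiff ℝ (⊤ : ℕ∞) fun x : Fin 4 → ℝ => η μ μ * x μ * G x ν :=
    (contDiff_const.mul (contDiff_apply ℝ ℝ μ)).mul (hGi ν)
  refine ⟨fun x μ ν => η μ μ * x μ * G x ν - η ν ν * x ν * G x μ,
    fun μ ν => (hW μ ν).sub (hW ν μ), fun x μ ν => by ring, fun ν x => ?_⟩
  have hdiv : ∑ μ, η μ μ * fderiv ℝ G x (Pi.single μ 1) μ = 0 := by
    have h := map_fderiv_radialAverage_eq_zero hJ
      (∑ μ : Fin 4, η μ μ • (ContinuousLinearMap.proj (R := ℝ) μ ∘L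
        ContinuousLinearMap.apply ℝ (Fin 4 → ℝ) (Pi.single μ 1 : Fin 4 → ℝ))) (fun y => ?_) x
    · simpa [_root_.sum_apply] using h
    · simpa [_root_.sum_apply, pd_apply (hJ.differentiable (by simp) y)]
        using hconserved y
  have heuler : 3 * G x ν + ∑ μ, x μ * fderiv ℝ G x (Pi.single μ 1) ν = J x ν := by
    have h := congrFun (three_smul_radialAverage_add_fderiv hJ x) ν
    have hx : fderiv ℝ G x x = ∑ μ, x μ • fderiv ℝ G x (Pi.single μ 1) := by
      conv_lhs => enter [2]; rw [← Finset.univ_sum_single x]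
      rw [map_sum]
      refine Finset.sum_congr rfl fun μ _ => ?_
      rw [← map_smul, ← Pi.single_smul, smul_eq_mul, mul_one]
    rw [Pi.add_apply, hx] at h
    simpa using h
  have hpd (μ : Fin 4) := pd_sub ((hW μ ν).differentiable (by simp) x)
    ((hW ν μ).differentiable (by simp) x) μ
  simp only [hpd, pd_mul_coord ((hGi _).differentiable (by simp) x), pd_apply (hGd x)]
  simp only [Fin.sum_univ_four] at hdiv heuler ⊢
  rw [← heuler]
  linear_combination (norm := (fin_cases ν <;> simp [η] <;> ring)) (-η ν ν * x ν) * hdiv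
end
end
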